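/- arXiv:2109.14763 — 3 statements merged into one kernel-verified Lean document; each statement's English description precedes it below -/
import Mathlib

section
/- Let X be a complete normed real vector space, let α ∈ (1/2, 1), β ∈ (2 - 1/α, 1), and c, C > 0. Let u : [0, ∞) → (0, ∞) and g : [0, ∞) → X be differentiable and assume that for all t ≥ 0: u'(t) ≤ -c·u(t)^{2α} and ‖g'(t)‖ ≤ C·(-u'(t))^{β/2}. Then g(t) converges to some g_∞ ∈ X as t → ∞, and there exists a constant C' depending only on α, β, c, C such that ‖g_∞ - g(t)‖ ≤ C'·t^{-θ} for all t ≥ 1, where θ = (1-(2-β)α)/(2α-1) > 0. -/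
open Filter Set Topology

/-- The decay of a positive solution of `u' ≤ -c u ^ p` with `p > 1`. -/
lemma le_rpow_of_deriv_le_neg_rpow {p c : ℝ} (hp : 1 < p) (hc : 0 < c) {u : ℝ → ℝ}
    (hu : ∀ t, 0 ≤ t → 0 < u t) (hd : ∀ t, 0 ≤ t → DifferentiableAt ℝ u t)
    (h : ∀ t, 0 ≤ t → deriv u t ≤ -c * u t ^ p) {t : ℝ} (ht : 0 < t) :
    u t ≤ (c * (p - 1) * t) ^ (-(1 / (p - 1))) := by
  have hp' : 0 < p - 1 := by linarith
  have hder : ∀ s, 0 ≤ s → HasDerivAt (fun s => u s ^ (1 - p) - c * (p - 1) * s)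
      (deriv u s * (1 - p) * u s ^ (1 - p - 1) - c * (p - 1)) s := fun s hs => by
    simpa using ((hd s hs).hasDerivAt.rpow_const (p := 1 - p) (Or.inl (hu s hs).ne')).fun_sub
      ((hasDerivAt_id s).const_mul (c * (p - 1)))
  have hmono : MonotoneOn (fun s => u s ^ (1 - p) - c * (p - 1) * s) (Ici 0) := by
    refine monotoneOn_of_deriv_nonneg (convex_Ici 0)
      (fun s hs => (hder s hs).continuousAt.continuousWithinAt)
      (fun s hs => ?_) (fun s hs => ?_)
    all_goals
      rw [interior_Ici] at hs
      have hs0 : 0 ≤ s := (mem_Ioi.1 hs).le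
    · exact (hder s hs0).differentiableAt.differentiableWithinAt
    · rw [(hder s hs0).deriv]
      have h1 : u s ^ p * u s ^ (1 - p - 1) = 1 := by
        rw [← Real.rpow_add (hu s hs0)]; simp
      have h2 := mul_le_mul_of_nonneg_right (h s hs0)
        (mul_nonneg hp'.le (Real.rpow_nonneg (hu s hs0).le (1 - p - 1)))
      have h3 : -c * u s ^ p * ((p - 1) * u s ^ (1 - p - 1)) = -c * (p - 1) := by
        linear_combination (-c * (p - 1)) * h1
      linarith
  have hle : c * (p - 1) * t ≤ u t ^ (1 - p) := by
    have h0 := hmono self_mem_Ici ht.le ht.le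
    have h1 := Real.rpow_nonneg (hu 0 le_rfl).le (1 - p)
    simp only [mul_zero, sub_zero] at h0
    linarith
  have hpos : 0 < c * (p - 1) * t := by positivity
  calc u t = (u t ^ (1 - p)) ^ (-(1 / (p - 1))) := by
        rw [← Real.rpow_mul (hu t ht.le).le,
          show (1 - p) * -(1 / (p - 1)) = 1 by field_simp; ring, Real.rpow_one]
    _ ≤ _ := Real.rpow_le_rpow_of_nonpos hpos hle (by simpa using hp'.le)

/-- If `‖g'‖ ≤ -B'` on `[0, ∞)`, then the increments of `g` are bounded by those of `-B`. -/
lemma norm_sub_le_of_norm_deriv_le_neg_deriv {X : Type*} [NormedAddCommGroup X]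
    [NormedSpace ℝ X] {g : ℝ → X} {B B' : ℝ → ℝ}
    (hg : ∀ t, 0 ≤ t → DifferentiableAt ℝ g t) (hB : ∀ t, 0 ≤ t → HasDerivAt B (B' t) t)
    (h : ∀ t, 0 ≤ t → ‖deriv g t‖ ≤ -B' t) {a b : ℝ} (ha : 0 ≤ a) (hab : a ≤ b) :
    ‖g b - g a‖ ≤ B a - B b := by
  refine image_norm_le_of_norm_deriv_right_le_deriv_boundary'
    (f := fun t => g t - g a) (f' := deriv g) (B := fun t => B a - B t) (B' := fun t => -B' t)
    (a := a) (b := b) ?_ ?_ (by simp) ?_ ?_ ?_ (right_mem_Icc.2 hab)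
  · exact fun t ht => ((hg t (ha.trans ht.1)).continuousAt.sub
      continuousAt_const).continuousWithinAt
  · exact fun t ht => ((hg t (ha.trans ht.1)).hasDerivAt.sub_const _).hasDerivWithinAt
  · exact fun t ht => (continuousAt_const.sub
      (hB t (ha.trans ht.1)).continuousAt).continuousWithinAt
  · exact fun t ht => ((hB t (ha.trans ht.1)).const_sub _).hasDerivWithinAt
  · exact fun t ht => h t (ha.trans ht.1)

/-- A curve whose increments after time `a` are at most `b a`, with `b → 0`, converges, and
`b` bounds its distance to the limit. -/
lemma exists_tendsto_of_norm_sub_le {X : Type*} [NormedAddCommGroup X] [CompleteSpace X]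
    {g : ℝ → X} {b : ℝ → ℝ} {t₀ : ℝ}
    (h : ∀ s t, t₀ ≤ s → s ≤ t → ‖g t - g s‖ ≤ b s) (hb : Tendsto b atTop (𝓝 0)) :
    ∃ l, Tendsto g atTop (𝓝 l) ∧ ∀ t, t₀ ≤ t → ‖l - g t‖ ≤ b t := by
  have hcauchy : CauchySeq g := by
    rw [Metric.cauchySeq_iff']
    intro ε hε
    obtain ⟨N, hN, hN'⟩ := ((hb.eventually_lt_const hε).and (eventually_ge_atTop t₀)).exists
    exact ⟨N, fun n hn => by rw [dist_eq_norm]; exact (h N n hN' hn).trans_lt hN⟩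
  obtain ⟨l, hl⟩ := cauchySeq_tendsto_of_complete hcauchy
  exact ⟨l, hl, fun t ht => le_of_tendsto (hl.sub_const (g t)).norm
    ((eventually_ge_atTop t).mono fun s hs => h t s ht hs)⟩


/-- Abstract Łojasiewicz–Simon convergence lemma with polynomial rate (heart of
Theorems 2.2/2.3 and Corollaries 1.3/1.4): if `u' ≤ -c·u^{2α}` and
`‖g'‖ ≤ C·(-u')^{β/2}` on `[0,∞)`, then `g(t)` converges to some `g_∞` with
`‖g_∞ - g(t)‖ ≤ C'·t^{-θ}` for `t ≥ 1`, where `θ = (1-(2-β)α)/(2α-1) > 0` and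
`C'` depends only on `α, β, c, C`. -/
theorem lojasiewicz_simon_convergence {X : Type*} [NormedAddCommGroup X]
    [NormedSpace ℝ X] [CompleteSpace X]
    (α β c C : ℝ) (hα : α ∈ Set.Ioo (1/2 : ℝ) 1)
    (hβ : β ∈ Set.Ioo (2 - 1/α) 1) (hc : 0 < c) (hC : 0 < C) :
    0 < (1 - (2 - β) * α) / (2 * α - 1) ∧
    ∃ C' : ℝ, ∀ (u : ℝ → ℝ) (g : ℝ → X),
      (∀ t : ℝ, 0 ≤ t → 0 < u t) →
      (∀ t : ℝ, 0 ≤ t → DifferentiableAt ℝ u t) →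
      (∀ t : ℝ, 0 ≤ t → DifferentiableAt ℝ g t) →
      (∀ t : ℝ, 0 ≤ t → deriv u t ≤ -c * u t ^ (2 * α)) →
      (∀ t : ℝ, 0 ≤ t → ‖deriv g t‖ ≤ C * (-deriv u t) ^ (β / 2)) →
      ∃ g_inf : X, Filter.Tendsto g Filter.atTop (nhds g_inf) ∧
        ∀ t : ℝ, 1 ≤ t →
          ‖g_inf - g t‖ ≤ C' * t ^ (-((1 - (2 - β) * α) / (2 * α - 1))) := by
  obtain ⟨hα1, hα2⟩ := hα
  obtain ⟨hβ1, hβ2⟩ := hβ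
  have hα0 : 0 < α := by linarith
  have hp : 0 < 2 * α - 1 := by linarith
  set η : ℝ := 1 - (2 - β) * α with hη_def
  have hη : 0 < η := by
    have h1 := mul_lt_mul_of_pos_right hβ1 hα0
    have h2 : (2 - 1 / α) * α = 2 * α - 1 := by field_simp
    linarith
  have hθ : 0 < η / (2 * α - 1) := div_pos hη hp
  refine ⟨hθ, C * c ^ (β / 2 - 1) / η * (c * (2 * α - 1)) ^ (-(η / (2 * α - 1))), ?_⟩
  intro u g hu hud hgd hu' hg'
  set K : ℝ := C * c ^ (β / 2 - 1) / η with hK_def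
  have hK : 0 < K := by positivity
  have hB : ∀ t, 0 ≤ t →
      HasDerivAt (fun s => K * u s ^ η) (K * (deriv u t * η * u t ^ (η - 1))) t :=
    fun t ht => ((hud t ht).hasDerivAt.rpow_const (Or.inl (hu t ht).ne')).const_mul K
  have hgB : ∀ t, 0 ≤ t → ‖deriv g t‖ ≤ -(K * (deriv u t * η * u t ^ (η - 1))) := by
    intro t ht
    have hut := hu t ht
    have hx : c * u t ^ (2 * α) ≤ -deriv u t := by linarith [hu' t ht]
    have hcu : 0 < c * u t ^ (2 * α) := by positivity
    have hx0 : 0 < -deriv u t := hcu.trans_le hx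
    calc ‖deriv g t‖ ≤ C * (-deriv u t) ^ (β / 2) := hg' t ht
      _ = C * ((-deriv u t) ^ (β / 2 - 1) * -deriv u t) := by
        rw [← Real.rpow_add_one hx0.ne', sub_add_cancel]
      _ ≤ C * ((c * u t ^ (2 * α)) ^ (β / 2 - 1) * -deriv u t) :=
        mul_le_mul_of_nonneg_left (mul_le_mul_of_nonneg_right
          (Real.rpow_le_rpow_of_nonpos hcu hx (by linarith)) hx0.le) hC.le
      _ = C * (c ^ (β / 2 - 1) * u t ^ (η - 1) * -deriv u t) := by
        rw [Real.mul_rpow hc.le (by positivity), ← Real.rpow_mul hut.le,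
          show 2 * α * (β / 2 - 1) = η - 1 by rw [hη_def]; ring]
      _ = _ := by rw [hK_def]; field_simp
  have hdecay : ∀ t, 0 < t → K * u t ^ η ≤
      K * (c * (2 * α - 1)) ^ (-(η / (2 * α - 1))) * t ^ (-(η / (2 * α - 1))) := by
    intro t ht
    have h1 := le_rpow_of_deriv_le_neg_rpow (by linarith : 1 < 2 * α) hc hu hud hu' ht
    rw [mul_assoc K, ← Real.mul_rpow (by positivity) ht.le]
    gcongr
    calc u t ^ η ≤ ((c * (2 * α - 1) * t) ^ (-(1 / (2 * α - 1)))) ^ η :=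
          Real.rpow_le_rpow (hu t ht.le).le h1 hη.le
      _ = _ := by
        rw [← Real.rpow_mul (by positivity)]
        congr 1
        ring
  refine exists_tendsto_of_norm_sub_le (fun s t hs hst => ?_) ?_
  · have hs0 : 0 ≤ s := zero_le_one.trans hs
    have h1 := norm_sub_le_of_norm_deriv_le_neg_deriv hgd hB hgB hs0 hst
    have h2 : 0 ≤ K * u t ^ η :=
      mul_nonneg hK.le (Real.rpow_nonneg (hu t (hs0.trans hst)).le _)
    linarith [hdecay s (zero_lt_one.trans_le hs)]
  · simpa using (tendsto_rpow_neg_atTop hθ).const_mul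
      (K * (c * (2 * α - 1)) ^ (-(η / (2 * α - 1))))
end

section
/- Let v : ℝ → ℝ be a nondecreasing function, let a < b be real numbers, and let δ > 0 and β > 0. Define E := { t ∈ [a, b] : v(t) - v(t - δ) ≥ β }. Then the Lebesgue measure of E satisfies |E| ≤ (2δ/β)·(v(b) - v(a - δ)). -/
/-- The integral over `[a, b]` of the backward increments of step `δ` of a monotone function. -/
theorem Monotone.intervalIntegral_sub_shift_le {v : ℝ → ℝ} (hv : Monotone v) (a b : ℝ) {δ : ℝ}
    (hδ : 0 ≤ δ) :
    ∫ t in a..b, (v t - v (t - δ)) ≤ δ * (v b - v (a - δ)) := by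
  have hint (x y : ℝ) : IntervalIntegrable v MeasureTheory.volume x y := hv.intervalIntegrable
  have hshift : Monotone fun t ↦ v (t - δ) := fun x y hxy ↦ hv (by linarith)
  have upper : ∫ t in (b - δ)..b, v t ≤ ∫ _ in (b - δ)..b, v b :=
    intervalIntegral.integral_mono_on (by linarith) (hint _ _) intervalIntegrable_const
      fun t ht ↦ hv ht.2
  have lower : ∫ _ in (a - δ)..a, v (a - δ) ≤ ∫ t in (a - δ)..a, v t :=
    intervalIntegral.integral_mono_on (by linarith) intervalIntegrable_const (hint _ _)
      fun t ht ↦ hv ht.1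
  rw [intervalIntegral.integral_const, smul_eq_mul] at upper lower
  rw [intervalIntegral.integral_sub (hint _ _) hshift.intervalIntegrable,
    intervalIntegral.integral_comp_sub_right,
    intervalIntegral.integral_interval_sub_interval_comm (hint _ _) (hint _ _) (hint _ _),
    intervalIntegral.integral_symm (a - δ) a, intervalIntegral.integral_symm (b - δ) b]
  linarith

/-- Covering/measure lemma from the proof of Proposition 6.1: for a nondecreasing
function `v`, the set of times `t ∈ [a,b]` at which `v(t) - v(t-δ) ≥ β` has
Lebesgue measure at most `(2δ/β)(v(b) - v(a-δ))`. -/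
theorem bad_times_measure_bound (v : ℝ → ℝ) (hv : Monotone v)
    (a b δ β : ℝ) (hab : a < b) (hδ : 0 < δ) (hβ : 0 < β) :
    MeasureTheory.volume {t ∈ Set.Icc a b | β ≤ v t - v (t - δ)} ≤
      ENNReal.ofReal (2 * δ / β * (v b - v (a - δ))) := by
  have hshift : Monotone fun t ↦ v (t - δ) := fun x y hxy ↦ hv (by linarith)
  have hE : {t ∈ Set.Icc a b | β ≤ v t - v (t - δ)} =
      {t | β ≤ v t - v (t - δ)} ∩ Set.Icc a b := Set.inter_comm _ _
  have hfin : MeasureTheory.volume ({t | β ≤ v t - v (t - δ)} ∩ Set.Icc a b) ≠ ⊤ :=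
    MeasureTheory.measure_ne_top_of_subset Set.inter_subset_right measure_Icc_lt_top.ne
  have hint : MeasureTheory.IntegrableOn (fun t ↦ v t - v (t - δ)) (Set.Icc a b) :=
    (hv.monotoneOn _).integrableOn_isCompact isCompact_Icc |>.sub
      ((hshift.monotoneOn _).integrableOn_isCompact isCompact_Icc)
  have markov := MeasureTheory.mul_meas_ge_le_integral_of_nonneg
    (Filter.Eventually.of_forall fun t ↦ sub_nonneg.2 (hv (by linarith : t - δ ≤ t))) hint β
  rw [MeasureTheory.measureReal_restrict_apply' measurableSet_Icc,
    MeasureTheory.integral_Icc_eq_integral_Ioc,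
    ← intervalIntegral.integral_of_le hab.le] at markov
  have bound := markov.trans (hv.intervalIntegral_sub_shift_le a b hδ.le)
  have hvab : 0 ≤ δ * (v b - v (a - δ)) :=
    mul_nonneg hδ.le (sub_nonneg.2 (hv (by linarith)))
  rw [hE, ← MeasureTheory.ofReal_measureReal hfin]
  refine ENNReal.ofReal_le_ofReal ?_
  rw [div_mul_eq_mul_div, le_div_iff₀ hβ]
  linarith
end

section
/- Let X be a complete normed real vector space, let α ∈ (1/2, 1), β ∈ (2 - 1/α, 1), and c, C > 0. Let u : [0, ∞) → (0, ∞) and g : [0, ∞) → X be differentiable and assume that for all t ≥ 0: u'(t) ≤ -c·u(t)^{2α} and ‖g'(t)‖ ≤ C·(-u'(t))^{β/2}. Then for all 0 ≤ t₁ ≤ t₂ one has ‖g(t₂) - g(t₁)‖ ≤ K·u(t₁)^{1-(2-β)α}, where K = C·c^{β/2-1}/(1 - (2-β)α) depends only on α, β, c, C. -/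
/-- Quantitative Cauchy estimate from the proof of Lemma A.2: if `-u' ≥ c·u^{2α}`
and `‖g'‖ ≤ C·(-u')^{β/2}` on `[0,∞)`, with `α ∈ (1/2,1)`, `β ∈ (2-1/α,1)`, then
`‖g(t₂) - g(t₁)‖ ≤ K·u(t₁)^{1-(2-β)α}` where `K = C·c^{β/2-1}/(1-(2-β)α)`. -/
theorem cauchy_estimate_entropy_gap {X : Type*} [NormedAddCommGroup X]
    [NormedSpace ℝ X] [CompleteSpace X]
    (α β c C : ℝ) (hα : α ∈ Set.Ioo (1/2 : ℝ) 1)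
    (hβ : β ∈ Set.Ioo (2 - 1/α) 1) (hc : 0 < c) (hC : 0 < C)
    (u : ℝ → ℝ) (g : ℝ → X)
    (hupos : ∀ t : ℝ, 0 ≤ t → 0 < u t)
    (hudiff : ∀ t : ℝ, 0 ≤ t → DifferentiableAt ℝ u t)
    (hgdiff : ∀ t : ℝ, 0 ≤ t → DifferentiableAt ℝ g t)
    (huineq : ∀ t : ℝ, 0 ≤ t → c * u t ^ (2 * α) ≤ -deriv u t)
    (hgineq : ∀ t : ℝ, 0 ≤ t → ‖deriv g t‖ ≤ C * (-deriv u t) ^ (β / 2)) :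
    ∀ t₁ t₂ : ℝ, 0 ≤ t₁ → t₁ ≤ t₂ →
      ‖g t₂ - g t₁‖ ≤
        C * c ^ (β / 2 - 1) / (1 - (2 - β) * α) * u t₁ ^ (1 - (2 - β) * α) := by
  have hα0 : 0 < α := by linarith [hα.1]
  have hθ : 0 < 1 - (2 - β) * α := by
    have h : 2 - β < 1 / α := by linarith [hβ.1]
    rw [lt_div_iff₀ hα0] at h
    linarith
  intro t₁ t₂ ht₁ ht₁₂
  set θ := 1 - (2 - β) * α with hθ_def
  set K := C * c ^ (β / 2 - 1) / θ with hK_def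
  have hK : 0 < K := by positivity
  have hB : ∀ t, 0 ≤ t → HasDerivAt (fun s => K * (u t₁ ^ θ - u s ^ θ))
      (K * -(deriv u t * θ * u t ^ (θ - 1))) t := fun t ht =>
    (((hudiff t ht).hasDerivAt.rpow_const (Or.inl (hupos t ht).ne')).const_sub _).const_mul K
  have hg : ∀ t, 0 ≤ t → HasDerivAt (fun s => g s - g t₁) (deriv g t) t := fun t ht =>
    (hgdiff t ht).hasDerivAt.sub_const _
  have key : ‖g t₂ - g t₁‖ ≤ K * (u t₁ ^ θ - u t₂ ^ θ) := by
    refine image_norm_le_of_norm_deriv_right_le_deriv_boundary'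
      (f := fun s => g s - g t₁) (B := fun s => K * (u t₁ ^ θ - u s ^ θ))
      (fun x hx => (hg x (ht₁.trans hx.1)).continuousAt.continuousWithinAt)
      (fun x hx => (hg x (ht₁.trans hx.1)).hasDerivWithinAt) (by simp)
      (fun x hx => (hB x (ht₁.trans hx.1)).continuousAt.continuousWithinAt)
      (fun x hx => (hB x (ht₁.trans hx.1)).hasDerivWithinAt) ?_
      (Set.right_mem_Icc.mpr ht₁₂)
    intro t ht
    have ht0 : 0 ≤ t := ht₁.trans ht.1
    have hu := hupos t ht0
    have hlow : 0 < c * u t ^ (2 * α) := by positivity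
    have hv : 0 < -deriv u t := hlow.trans_le (huineq t ht0)
    have hpow : (-deriv u t) ^ (β / 2 - 1) ≤ c ^ (β / 2 - 1) * u t ^ (θ - 1) := by
      calc (-deriv u t) ^ (β / 2 - 1) ≤ (c * u t ^ (2 * α)) ^ (β / 2 - 1) :=
            Real.rpow_le_rpow_of_nonpos hlow (huineq t ht0) (by linarith [hβ.2])
        _ = c ^ (β / 2 - 1) * u t ^ (θ - 1) := by
            rw [Real.mul_rpow hc.le (by positivity), ← Real.rpow_mul hu.le]
            congr 2
            rw [hθ_def]
            ring
    calc ‖deriv g t‖ ≤ C * (-deriv u t) ^ (β / 2) := hgineq t ht0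
      _ = C * ((-deriv u t) ^ (β / 2 - 1) * -deriv u t) := by
          rw [← Real.rpow_add_one hv.ne', sub_add_cancel]
      _ ≤ C * (c ^ (β / 2 - 1) * u t ^ (θ - 1) * -deriv u t) := by gcongr
      _ = K * -(deriv u t * θ * u t ^ (θ - 1)) := by
          rw [hK_def]
          field_simp
  have hu₂ : 0 < u t₂ ^ θ := Real.rpow_pos_of_pos (hupos t₂ (ht₁.trans ht₁₂)) θ
  exact key.trans (mul_le_mul_of_nonneg_left (by linarith) hK.le)
end
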